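/- Let V_4 × S_2 ⊂ S_7 be the subgroup of order 8 generated by the permutations (23)(45), (24)(35), and (67), acting on Q^7 by permuting coordinates. Then its Molien series (1/8) Σ_{A∈G} 1/det(1 - tA) equals (1 - t + t^2)/((1-t)^4 (1-t^2)^3). -/

import Mathlib

open PowerSeries

/-- The permutation matrix of `σ`, with entries in `ℚ⟦t⟧`. -/
noncomputable def permMatrixPS {m : ℕ} (σ : Equiv.Perm (Fin m)) :
    Matrix (Fin m) (Fin m) (PowerSeries ℚ) :=
  Matrix.of fun i j => if σ j = i then 1 else 0

/-- The subgroup `V₄ × S₂ ⊂ S₇` generated by `(23)(45)`, `(24)(35)` and `(67)`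
(written here on the letters `{0,…,6}`, shifted down by one). -/
noncomputable def V4xS2 : Subgroup (Equiv.Perm (Fin 7)) :=
  Subgroup.closure
    {Equiv.swap 1 2 * Equiv.swap 3 4, Equiv.swap 1 3 * Equiv.swap 2 4, Equiv.swap 5 6}


/-- The first generator. -/
def gA : Equiv.Perm (Fin 7) := Equiv.swap 1 2 * Equiv.swap 3 4
/-- The second generator. -/
def gB : Equiv.Perm (Fin 7) := Equiv.swap 1 3 * Equiv.swap 2 4
/-- The third generator. -/
def gC : Equiv.Perm (Fin 7) := Equiv.swap 5 6

/-- The list of the eight elements of the group. -/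
def elts : Finset (Equiv.Perm (Fin 7)) :=
  {1, gA, gB, gA * gB, gC, gA * gC, gB * gC, gA * gB * gC}

set_option maxRecDepth 100000 in
theorem elts_mul : ∀ a ∈ elts, ∀ b ∈ elts, a * b ∈ elts := by decide +kernel

set_option maxRecDepth 100000 in
theorem elts_inv : ∀ a ∈ elts, a⁻¹ ∈ elts := by decide +kernel

set_option maxRecDepth 100000 in
theorem elts_card : elts.card = 8 := by decide +kernel

/-- The eight elements as a subgroup. -/
def eltsGroup : Subgroup (Equiv.Perm (Fin 7)) where
  carrier := {a | a ∈ elts}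
  mul_mem' := fun {a b} ha hb => elts_mul a ha b hb
  one_mem' := by simp [elts]
  inv_mem' := fun {a} ha => elts_inv a ha

theorem mem_V4xS2 (a : Equiv.Perm (Fin 7)) : a ∈ V4xS2 ↔ a ∈ elts := by
  constructor
  · intro h
    have h1 : V4xS2 ≤ eltsGroup := by
      refine (Subgroup.closure_le _).2 ?_
      rintro x (rfl | rfl | rfl)
      · change gA ∈ elts
        simp [elts]
      · change gB ∈ elts
        simp [elts]
      · change gC ∈ elts
        simp [elts]
    exact h1 h
  · intro h
    have hA : gA ∈ V4xS2 := Subgroup.subset_closure (by simp [gA])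
    have hB : gB ∈ V4xS2 := Subgroup.subset_closure (by simp [gB])
    have hC : gC ∈ V4xS2 := Subgroup.subset_closure (by simp [gC])
    simp only [elts, Finset.mem_insert, Finset.mem_singleton] at h
    rcases h with rfl | rfl | rfl | rfl | rfl | rfl | rfl | rfl
    · exact one_mem _
    · exact hA
    · exact hB
    · exact mul_mem hA hB
    · exact hC
    · exact mul_mem hA hC
    · exact mul_mem hB hC
    · exact mul_mem (mul_mem hA hB) hC

/-- The determinant occurring in the Molien series. -/
noncomputable def dt (σ : Equiv.Perm (Fin 7)) : PowerSeries ℚ :=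
  Matrix.det (1 - (PowerSeries.X : PowerSeries ℚ) • permMatrixPS σ)

theorem dt_conj (τ σ ρ : Equiv.Perm (Fin 7)) (h : τ * σ = ρ * τ) : dt σ = dt ρ := by
  unfold dt
  rw [← Matrix.det_submatrix_equiv_self τ (1 - (PowerSeries.X : PowerSeries ℚ) • permMatrixPS ρ)]
  congr 1
  ext1 i j
  have hj : ρ (τ j) = τ (σ j) := by
    have := congrArg (fun f : Equiv.Perm (Fin 7) => f j) h
    simpa using this.symm
  simp [permMatrixPS, Matrix.one_apply, hj]

/-- Generic block diagonal determinant with two by two blocks. -/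
theorem det_block (R : Type) [CommRing R] (x a b c d e f : R) :
    Matrix.det !![x,0,0,0,0,0,0; 0,a,b,0,0,0,0; 0,b,a,0,0,0,0; 0,0,0,c,d,0,0; 0,0,0,d,c,0,0;
      0,0,0,0,0,e,f; 0,0,0,0,0,f,e] =
      x * (a ^ 2 - b ^ 2) * (c ^ 2 - d ^ 2) * (e ^ 2 - f ^ 2) := by
  simp [Matrix.det_succ_row_zero, Fin.sum_univ_succ, Fin.succAbove]
  ring

theorem perm_one : (1 - (X : PowerSeries ℚ) • permMatrixPS (1 : Equiv.Perm (Fin 7))) =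
    !![1-X,0,0,0,0,0,0; 0,1-X,0,0,0,0,0; 0,0,1-X,0,0,0,0; 0,0,0,1-X,0,0,0; 0,0,0,0,1-X,0,0;
      0,0,0,0,0,1-X,0; 0,0,0,0,0,0,1-X] := by
  ext1 i j
  fin_cases i <;> fin_cases j <;> simp [permMatrixPS]

theorem perm_C : (1 - (X : PowerSeries ℚ) • permMatrixPS gC) =
    !![1-X,0,0,0,0,0,0; 0,1-X,0,0,0,0,0; 0,0,1-X,0,0,0,0; 0,0,0,1-X,0,0,0; 0,0,0,0,1-X,0,0;
      0,0,0,0,0,1,-X; 0,0,0,0,0,-X,1] := by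
  ext1 i j
  fin_cases i <;> fin_cases j <;> simp [permMatrixPS, gC, Equiv.swap_apply_def]

theorem perm_A : (1 - (X : PowerSeries ℚ) • permMatrixPS gA) =
    !![1-X,0,0,0,0,0,0; 0,1,-X,0,0,0,0; 0,-X,1,0,0,0,0; 0,0,0,1,-X,0,0; 0,0,0,-X,1,0,0;
      0,0,0,0,0,1-X,0; 0,0,0,0,0,0,1-X] := by
  ext1 i j
  fin_cases i <;> fin_cases j <;> simp [permMatrixPS, gA, Equiv.swap_apply_def]

theorem perm_AC : (1 - (X : PowerSeries ℚ) • permMatrixPS (gA * gC)) =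
    !![1-X,0,0,0,0,0,0; 0,1,-X,0,0,0,0; 0,-X,1,0,0,0,0; 0,0,0,1,-X,0,0; 0,0,0,-X,1,0,0;
      0,0,0,0,0,1,-X; 0,0,0,0,0,-X,1] := by
  ext1 i j
  fin_cases i <;> fin_cases j <;> simp [permMatrixPS, gA, gC, Equiv.swap_apply_def]

theorem dt_one : dt 1 = (1 - X) ^ 7 := by
  rw [dt, perm_one, det_block]; ring
theorem dt_C : dt gC = (1 - X) ^ 5 * (1 - X ^ 2) := by
  rw [dt, perm_C, det_block]; ring
theorem dt_A : dt gA = (1 - X) ^ 3 * (1 - X ^ 2) ^ 2 := by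
  rw [dt, perm_A, det_block]; ring
theorem dt_AC : dt (gA * gC) = (1 - X) * (1 - X ^ 2) ^ 3 := by
  rw [dt, perm_AC, det_block]; ring

theorem dt_B : dt gB = dt gA := dt_conj (Equiv.swap 2 3) _ _ (by decide)
theorem dt_BC : dt (gB * gC) = dt (gA * gC) := dt_conj (Equiv.swap 2 3) _ _ (by decide)
theorem dt_AB : dt (gA * gB) = dt gA := dt_conj (Equiv.swap 2 4) _ _ (by decide)
theorem dt_ABC : dt (gA * gB * gC) = dt (gA * gC) := dt_conj (Equiv.swap 2 4) _ _ (by decide)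

set_option maxRecDepth 100000 in
theorem sum_elts (f : Equiv.Perm (Fin 7) → PowerSeries ℚ) : ∑ σ ∈ elts, f σ =
    f 1 + (f gA + (f gB + (f (gA * gB) + (f gC + (f (gA * gC) + (f (gB * gC) +
      f (gA * gB * gC))))))) := by
  unfold elts
  rw [Finset.sum_insert (by decide), Finset.sum_insert (by decide), Finset.sum_insert (by decide),
    Finset.sum_insert (by decide), Finset.sum_insert (by decide), Finset.sum_insert (by decide),
    Finset.sum_insert (by decide), Finset.sum_singleton]

theorem inv_pow_ps (u : PowerSeries ℚ) (n : ℕ) : (u ^ n)⁻¹ = u⁻¹ ^ n := by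
  induction n with
  | zero => simp
  | succ n ih => rw [pow_succ, PowerSeries.mul_inv_rev, ih, pow_succ, mul_comm]

/-- The subgroup `V₄ × S₂ = ⟨(23)(45), (24)(35), (67)⟩ ⊂ S₇` has order 8, and the Molien
series `(1/8) ∑_{A ∈ G} 1/det(1 - tA)` of its permutation action on `ℚ⁷` equals
`(1 - t + t²)/((1-t)⁴ (1-t²)³)`. -/
theorem molien_V4xS2 :
    Nat.card V4xS2 = 8 ∧
    (8 : ℚ)⁻¹ • ∑ᶠ σ : V4xS2,
        (Matrix.det (1 - (PowerSeries.X : PowerSeries ℚ) •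
          permMatrixPS (σ : Equiv.Perm (Fin 7))))⁻¹ =
      (1 - PowerSeries.X + PowerSeries.X ^ 2) *
        ((1 - (PowerSeries.X : PowerSeries ℚ))⁻¹) ^ 4 *
        ((1 - (PowerSeries.X : PowerSeries ℚ) ^ 2)⁻¹) ^ 3 := by
  constructor
  · have h : (V4xS2 : Set (Equiv.Perm (Fin 7))) = (elts : Set (Equiv.Perm (Fin 7))) := by
      ext a
      exact mem_V4xS2 a
    change Nat.card (V4xS2 : Set (Equiv.Perm (Fin 7))) = 8
    rw [h]
    simp [elts_card]
  · have hs : ∑ᶠ σ : V4xS2, (Matrix.det (1 - (PowerSeries.X : PowerSeries ℚ) •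
          permMatrixPS (σ : Equiv.Perm (Fin 7))))⁻¹ = ∑ σ ∈ elts, (dt σ)⁻¹ := by
      rw [← finsum_mem_coe_finset]
      have h : (elts : Set (Equiv.Perm (Fin 7))) = (V4xS2 : Set (Equiv.Perm (Fin 7))) := by
        ext a
        exact (mem_V4xS2 a).symm
      rw [h]
      exact finsum_set_coe_eq_finsum_mem (f := fun σ => (dt σ)⁻¹)
        (V4xS2 : Set (Equiv.Perm (Fin 7)))
    rw [hs, sum_elts, dt_ABC, dt_AB, dt_BC, dt_B, dt_one, dt_C, dt_A, dt_AC]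
    simp only [PowerSeries.mul_inv_rev, inv_pow_ps]
    have hu : (1 - X : PowerSeries ℚ) * (1 - X)⁻¹ = 1 := PowerSeries.mul_inv_cancel _ (by simp)
    have hv : (1 - X ^ 2 : PowerSeries ℚ) * (1 - X ^ 2)⁻¹ = 1 :=
      PowerSeries.mul_inv_cancel _ (by simp)
    have hu0 : (1 - X : PowerSeries ℚ) ≠ 0 := left_ne_zero_of_mul_eq_one hu
    have hv0 : (1 - X ^ 2 : PowerSeries ℚ) ≠ 0 := left_ne_zero_of_mul_eq_one hv
    have hw : (1 - X : PowerSeries ℚ)⁻¹ = (1 + X) * (1 - X ^ 2)⁻¹ := by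
      apply mul_left_cancel₀ hu0
      rw [hu]
      linear_combination -hv
    have key : ∀ p q : PowerSeries ℚ, p = 8 * q → (8 : ℚ)⁻¹ • p = q := by
      intro p q h
      have : (8 : PowerSeries ℚ) * q = (8 : ℚ) • q := by
        rw [PowerSeries.smul_eq_C_mul, map_ofNat]
      rw [h, this, smul_smul]; norm_num
    apply key
    rw [hw]
    generalize (1 - X ^ 2 : PowerSeries ℚ)⁻¹ = v at *
    apply mul_left_cancel₀ (pow_ne_zero 7 hv0)
    have hv7 : (1 - X ^ 2 : PowerSeries ℚ) ^ 7 * v ^ 7 = 1 := by rw [← mul_pow, hv, one_pow]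
    have hv6 : (1 - X ^ 2 : PowerSeries ℚ) ^ 7 * v ^ 6 = 1 - X ^ 2 := by
      rw [pow_succ', mul_assoc, ← mul_pow, hv, one_pow, mul_one]
    have hv5 : (1 - X ^ 2 : PowerSeries ℚ) ^ 7 * v ^ 5 = (1 - X ^ 2) ^ 2 := by
      rw [pow_add _ 2 5, mul_assoc, ← mul_pow, hv, one_pow, mul_one]
    have hv4 : (1 - X ^ 2 : PowerSeries ℚ) ^ 7 * v ^ 4 = (1 - X ^ 2) ^ 3 := by
      rw [pow_add _ 3 4, mul_assoc, ← mul_pow, hv, one_pow, mul_one]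
    linear_combination ((1 + X) ^ 7 - 8 * (1 - X + X ^ 2) * (1 + X) ^ 4) * hv7 +
      (1 + X) ^ 5 * hv6 + 3 * (1 + X) ^ 3 * hv5 + 3 * (1 + X) * hv4
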